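/- For any n ≥ 51 with n ≡ 1 (mod 3), there exists a clustering instance X ⊂ ℝ on n points and a ground-truth 2-clustering G of X such that: ζ_{2,SL}(X) = n; the clusters C = SingleLinkage(X,2) satisfy min_{C_i∈C} |C_i| ≥ n/6; and for a random subsample X_m of m = n−1 points drawn uniformly with replacement from X, with probability at least 0.23, |cost(SingleLinkage(X_m,2);G) − cost(SingleLinkage(X,2);G)| ≥ 1/12. -/

import Mathlib

open scoped Classical
open Real

noncomputable section

variable {P : Type*} [MetricSpace P]

/-- The maximum distance between consecutive points of a list (`0` for lists of length `≤ 1`). -/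
def pathCost (p : List P) : ℝ := ((p.zip p.tail).map fun q => dist q.1 q.2).foldr max 0

/-- Min-max (bottleneck) distance between `x` and `y` within the finite set `X`. -/
def minMaxD (X : Finset P) (x y : P) : ℝ :=
  sInf { r | ∃ p : List P, p ≠ [] ∧ p.Nodup ∧ (∀ a ∈ p, a ∈ X) ∧
    p.head? = some x ∧ p.getLast? = some y ∧ r = pathCost p }

/-- `d_MM(S; X) = max_{x,y ∈ S} d_MM(x,y;X)`. -/
def minMaxSet (X : Finset P) (S : Set P) : ℝ :=
  sSup { r | ∃ x ∈ S, ∃ y ∈ S, r = minMaxD X x y }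

/-- One merge step of single linkage at distance threshold `D`. -/
def SLStep (X : Finset P) (D : ℝ) (a b : P) : Prop := a ∈ X ∧ b ∈ X ∧ dist a b ≤ D

/-- Two points lie in a common single-linkage cluster at distance threshold `D`. -/
def SLLinked (X : Finset P) (D : ℝ) : P → P → Prop := Relation.ReflTransGen (SLStep X D)

/-- The merge distance at iteration `i` of single linkage on `X`. -/
def mergeDist (X : Finset P) : ℕ → ℝ
  | 0 => 0
  | (i+1) => sInf { r | ∃ x ∈ X, ∃ y ∈ X, ¬ SLLinked X (mergeDist X i) x y ∧ r = dist x y }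

/-- The clusters of single linkage on `X` at distance threshold `D`. -/
def clustersAt (X : Finset P) (D : ℝ) : Set (Set P) :=
  { C | ∃ x ∈ X, C = { y | y ∈ X ∧ SLLinked X D x y } }

/-- `C` is the `k`-clustering output by SingleLinkage(X,k). -/
def IsSLClustering (X : Finset P) (k : ℕ) (C : Set (Set P)) : Prop :=
  ∃ ℓ : ℕ, C = clustersAt X (mergeDist X ℓ) ∧ C.ncard = k

/-- The output of SingleLinkage(X,k): the clusters at the first iteration at which exactly `k`
clusters remain (junk value `∅` if no iteration leaves exactly `k` clusters). -/
def SLClusters (X : Finset P) (k : ℕ) : Set (Set P) :=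
  if h : ∃ ℓ : ℕ, (clustersAt X (mergeDist X ℓ)).ncard = k then
    clustersAt X (mergeDist X (Nat.find h))
  else ∅

/-- `ζ_{k,SL}(X)`, expressed relative to an enumeration `C` of the single-linkage clusters. -/
def zetaSL {k : ℕ} (X : Finset P) (C : Fin k → Set P) : ℝ :=
  (X.card : ℝ) *
    ((⌈(sInf { r | ∃ i j : Fin k, i ≠ j ∧ r = minMaxSet X (C i ∪ C j) } -
        sSup { r | ∃ t : Fin k, r = minMaxSet X (C t) }) /
        sSup { r | ∃ t : Fin k, r = minMaxSet X (C t) }⌉ : ℝ))⁻¹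

/-- The cost `cost(C;G)` of a `k`-clustering `C` of `S` with respect to a ground-truth
`k`-clustering `G` of `X`:
`(1/|S|)·min_{σ ∈ Sym([k])} #{x ∈ S : ∃ j, x ∈ C_{σ(j)} ∧ x ∉ G_j}`, where the minimum also
ranges over enumerations of the unindexed family `C`. -/
def costSet {k : ℕ} (S : Finset P) (C : Set (Set P)) (Gt : Fin k → Set P) : ℝ :=
  (S.card : ℝ)⁻¹ *
    sInf { c : ℝ | ∃ f : Fin k → Set P, Function.Injective f ∧ Set.range f = C ∧
      ∃ σ : Equiv.Perm (Fin k),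
        c = ({ x ∈ (S : Set P) | ∃ j, x ∈ f (σ j) ∧ x ∉ Gt j }.ncard : ℝ) }

/-- `Gt` is a ground-truth `k`-clustering of `X`: a partition of `X` into `k` disjoint subsets. -/
def IsGroundTruth {k : ℕ} (X : Finset P) (Gt : Fin k → Set P) : Prop :=
  (∀ i, Gt i ⊆ ↑X) ∧ Pairwise (fun i j => Disjoint (Gt i) (Gt j)) ∧ (⋃ i, Gt i) = ↑X

/-- The set of points appearing in a sample `ω` of `m` draws from `X`. -/
def sampleFinset {m : ℕ} (X : Finset P) (ω : Fin m → {x // x ∈ X}) : Finset P :=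
  Finset.image (fun i => (ω i : P)) Finset.univ

/-- Probability of an event under the uniform distribution on a finite type. -/
def unifProb {α : Type*} [Fintype α] (E : Set α) : ℝ :=
  ((Finset.univ.filter fun a => a ∈ E).card : ℝ) / (Fintype.card α : ℝ)

theorem SLLinked.symm {X : Finset P} {D : ℝ} {x y : P} (h : SLLinked X D x y) :
    SLLinked X D y x := by
  induction h with
  | refl => exact Relation.ReflTransGen.refl
  | tail _ hbc ih =>
    exact Relation.ReflTransGen.head ⟨hbc.2.1, hbc.1, (dist_comm _ _).trans_le hbc.2.2⟩ ih

theorem SLLinked.mono {X : Finset P} {D E : ℝ} (hDE : D ≤ E) {x y : P} (h : SLLinked X D x y) :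
    SLLinked X E x y := by
  induction h with
  | refl => exact Relation.ReflTransGen.refl
  | tail _ hbc ih => exact ih.tail ⟨hbc.1, hbc.2.1, hbc.2.2.trans hDE⟩

theorem SLLinked.of_dist_le {X : Finset P} {D : ℝ} {x y : P} (hx : x ∈ X) (hy : y ∈ X)
    (h : dist x y ≤ D) : SLLinked X D x y :=
  Relation.ReflTransGen.single ⟨hx, hy, h⟩

/-- If two sides of `X` are more than `D` apart, links at threshold `D` stay on one side. -/
theorem SLLinked.mem_of_separated {X : Finset P} {D : ℝ} {L R : Set P} (hX : (X : Set P) = L ∪ R)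
    (hsep : ∀ x ∈ L, ∀ y ∈ R, D < dist x y) {x y : P} (hx : x ∈ L) (h : SLLinked X D x y) :
    y ∈ L := by
  induction h with
  | refl => exact hx
  | @tail b c _ hbc ih =>
    have hc : c ∈ L ∪ R := hX ▸ hbc.2.1
    rcases hc with hc | hc
    · exact hc
    · exact absurd hbc.2.2 (not_le.2 (hsep b ih c hc))

theorem SLLinked.exists_step_not_linked {X : Finset P} {D g : ℝ} {x y : P}
    (h : SLLinked X g x y) (hn : ¬ SLLinked X D x y) :
    ∃ a ∈ X, ∃ b ∈ X, dist a b ≤ g ∧ ¬ SLLinked X D a b := by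
  induction h with
  | refl => exact absurd Relation.ReflTransGen.refl hn
  | @tail b c _ hbc ih =>
    by_cases hb : SLLinked X D x b
    · exact ⟨b, hbc.1, c, hbc.2.1, hbc.2.2, fun hh => hn (Relation.ReflTransGen.trans hb hh)⟩
    · exact ih hb

theorem finite_unlinked_dist (X : Finset P) (D : ℝ) :
    { r | ∃ x ∈ X, ∃ y ∈ X, ¬ SLLinked X D x y ∧ r = dist x y }.Finite := by
  refine ((X ×ˢ X).image fun q : P × P => dist q.1 q.2).finite_toSet.subset ?_
  rintro r ⟨x, hx, y, hy, -, rfl⟩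
  exact Finset.mem_coe.2 (Finset.mem_image.2 ⟨(x, y), Finset.mk_mem_product hx hy, rfl⟩)

theorem mergeDist_succ_mem {X : Finset P} {i : ℕ} {a b : P} (ha : a ∈ X) (hb : b ∈ X)
    (hab : ¬ SLLinked X (mergeDist X i) a b) :
    mergeDist X (i + 1) ∈
      { r | ∃ x ∈ X, ∃ y ∈ X, ¬ SLLinked X (mergeDist X i) x y ∧ r = dist x y } :=
  Set.Nonempty.csInf_mem ⟨_, a, ha, b, hb, hab, rfl⟩ (finite_unlinked_dist _ _)

theorem mergeDist_lt_succ {X : Finset P} {i : ℕ} {a b : P} (ha : a ∈ X) (hb : b ∈ X)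
    (hab : ¬ SLLinked X (mergeDist X i) a b) : mergeDist X i < mergeDist X (i + 1) := by
  obtain ⟨x, hx, y, hy, hxy, h⟩ := mergeDist_succ_mem ha hb hab
  rw [h]
  exact not_le.1 fun hle => hxy (SLLinked.of_dist_le hx hy hle)

theorem mergeDist_succ_le {X : Finset P} {i : ℕ} {a b : P} (ha : a ∈ X) (hb : b ∈ X)
    (hab : ¬ SLLinked X (mergeDist X i) a b) : mergeDist X (i + 1) ≤ dist a b :=
  csInf_le (finite_unlinked_dist _ _).bddBelow ⟨a, ha, b, hb, hab, rfl⟩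

/-- Single linkage eventually links every pair that is linked at threshold `g`, before its merge
distance exceeds `g`. -/
theorem exists_mergeDist_linked (X : Finset P) {g : ℝ} (hg : 0 ≤ g) :
    ∃ ℓ, (∀ j ≤ ℓ, mergeDist X j ≤ g) ∧
      ∀ x y, SLLinked X g x y → SLLinked X (mergeDist X ℓ) x y := by
  have hex : ∃ ℓ, ∀ x y, SLLinked X g x y → SLLinked X (mergeDist X ℓ) x y := by
    by_contra! hcon
    have hstep : ∀ ℓ, ∃ a ∈ X, ∃ b ∈ X, ¬ SLLinked X (mergeDist X ℓ) a b := fun ℓ => by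
      obtain ⟨x, y, hxy, hn⟩ := hcon ℓ
      obtain ⟨a, ha, b, hb, -, hab⟩ := hxy.exists_step_not_linked hn
      exact ⟨a, ha, b, hb, hab⟩
    have hmono : StrictMono (mergeDist X) := strictMono_nat_of_lt_succ fun ℓ => by
      obtain ⟨a, ha, b, hb, hab⟩ := hstep ℓ
      exact mergeDist_lt_succ ha hb hab
    refine Set.infinite_range_of_injective (f := fun ℓ => mergeDist X (ℓ + 1))
      (fun i j hij => Nat.succ_injective (hmono.injective hij))
      (((X ×ˢ X).image fun q : P × P => dist q.1 q.2).finite_toSet.subset ?_)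
    rintro _ ⟨ℓ, rfl⟩
    obtain ⟨a, ha, b, hb, hab⟩ := hstep ℓ
    obtain ⟨x, hx, y, hy, -, h⟩ := mergeDist_succ_mem ha hb hab
    exact Finset.mem_coe.2 (Finset.mem_image.2 ⟨(x, y), Finset.mk_mem_product hx hy, h.symm⟩)
  refine ⟨Nat.find hex, fun j => ?_, Nat.find_spec hex⟩
  induction j with
  | zero => exact fun _ => hg
  | succ j _ =>
    intro hj
    have hnot := Nat.find_min hex (Nat.lt_of_succ_le hj)
    push Not at hnot
    obtain ⟨x, y, hxy, hn⟩ := hnot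
    obtain ⟨a, ha, b, hb, hle, hab⟩ := hxy.exists_step_not_linked hn
    exact (mergeDist_succ_le ha hb hab).trans hle

theorem clustersAt_eq_pair {X : Finset P} {L R : Set P} (hX : (X : Set P) = L ∪ R)
    (hL : L.Nonempty) (hR : R.Nonempty) {D : ℝ} (hsep : ∀ x ∈ L, ∀ y ∈ R, D < dist x y)
    (hLl : ∀ x ∈ L, ∀ y ∈ L, SLLinked X D x y) (hRl : ∀ x ∈ R, ∀ y ∈ R, SLLinked X D x y) :
    clustersAt X D = {L, R} := by
  have hXm : ∀ x, x ∈ X ↔ x ∈ L ∨ x ∈ R := fun x => by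
    rw [← Finset.mem_coe, hX, Set.mem_union]
  have hsep' : ∀ x ∈ R, ∀ y ∈ L, D < dist x y := fun x hx y hy => dist_comm x y ▸ hsep y hy x hx
  have hLc : ∀ x ∈ L, { y | y ∈ X ∧ SLLinked X D x y } = L := fun x hx =>
    Set.Subset.antisymm (fun y hy => hy.2.mem_of_separated hX hsep hx)
      fun y hy => ⟨(hXm y).2 (Or.inl hy), hLl x hx y hy⟩
  have hRc : ∀ x ∈ R, { y | y ∈ X ∧ SLLinked X D x y } = R := fun x hx =>
    Set.Subset.antisymm
      (fun y hy => hy.2.mem_of_separated (hX.trans (Set.union_comm L R)) hsep' hx)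
      fun y hy => ⟨(hXm y).2 (Or.inr hy), hRl x hx y hy⟩
  ext T
  constructor
  · rintro ⟨x, hx, rfl⟩
    rcases (hXm x).1 hx with h | h
    · exact Or.inl (hLc x h)
    · exact Or.inr (hRc x h)
  · rintro (rfl | rfl)
    · obtain ⟨x, hx⟩ := hL
      exact ⟨x, (hXm x).2 (Or.inl hx), (hLc x hx).symm⟩
    · obtain ⟨x, hx⟩ := hR
      exact ⟨x, (hXm x).2 (Or.inr hx), (hRc x hx).symm⟩

/-- When exactly two clusters remain below the separation of `L` and `R`, the side `L` is
internally linked. -/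
theorem linked_of_ncard_clustersAt_eq_two {X : Finset P} {L R : Set P}
    (hX : (X : Set P) = L ∪ R) (hdisj : Disjoint L R) (hR : R.Nonempty) {D : ℝ}
    (hsep : ∀ x ∈ L, ∀ y ∈ R, D < dist x y) (hcard : (clustersAt X D).ncard = 2) :
    ∀ x ∈ L, ∀ y ∈ L, SLLinked X D x y := by
  intro x hx y hy
  obtain ⟨r, hr⟩ := hR
  have hXm : ∀ x, x ∈ L ∨ x ∈ R → x ∈ X := fun x h => by
    rw [← Finset.mem_coe, hX]; exact h
  obtain ⟨u, v, -, huv⟩ := Set.ncard_eq_two.1 hcard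
  have hmem : ∀ z ∈ X, { y | y ∈ X ∧ SLLinked X D z y } = u ∨
      { y | y ∈ X ∧ SLLinked X D z y } = v := fun z hz => by
    have : { y | y ∈ X ∧ SLLinked X D z y } ∈ clustersAt X D := ⟨z, hz, rfl⟩
    rwa [huv] at this
  have hne : ∀ z ∈ L, { y | y ∈ X ∧ SLLinked X D z y } ≠ { y | y ∈ X ∧ SLLinked X D r y } := by
    intro z hz heq
    have hrr : r ∈ { y | y ∈ X ∧ SLLinked X D z y } :=
      heq ▸ ⟨hXm r (Or.inr hr), Relation.ReflTransGen.refl⟩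
    exact Set.disjoint_left.1 hdisj (hrr.2.mem_of_separated hX hsep hz) hr
  have hxy : { z | z ∈ X ∧ SLLinked X D x z } = { z | z ∈ X ∧ SLLinked X D y z } := by
    have h1 := hne x hx
    have h2 := hne y hy
    rcases hmem r (hXm r (Or.inr hr)) with hr' | hr' <;>
    rcases hmem x (hXm x (Or.inl hx)) with hx' | hx' <;>
    rcases hmem y (hXm y (Or.inl hy)) with hy' | hy' <;>
    simp_all only [ne_eq, not_true_eq_false]
  have hyy : y ∈ { z | z ∈ X ∧ SLLinked X D x z } :=
    hxy ▸ ⟨hXm y (Or.inl hy), Relation.ReflTransGen.refl⟩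
  exact hyy.2

theorem SLClusters_two_eq_pair {X : Finset P} {L R : Set P} (hX : (X : Set P) = L ∪ R)
    (hL : L.Nonempty) (hR : R.Nonempty) {g : ℝ} (hg : 0 ≤ g)
    (hsep : ∀ x ∈ L, ∀ y ∈ R, g < dist x y)
    (hLl : ∀ x ∈ L, ∀ y ∈ L, SLLinked X g x y) (hRl : ∀ x ∈ R, ∀ y ∈ R, SLLinked X g x y) :
    IsSLClustering X 2 {L, R} ∧ SLClusters X 2 = {L, R} := by
  have hdisj : Disjoint L R := Set.disjoint_left.2 fun x hxL hxR => by
    have := hsep x hxL x hxR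
    rw [dist_self] at this
    exact absurd hg (not_le.2 this)
  have hne : L ≠ R := fun h => hL.ne_empty (disjoint_self.1 (h ▸ hdisj : Disjoint L L))
  obtain ⟨ℓ, hle, hlink⟩ := exists_mergeDist_linked X hg
  have hsepj : ∀ j ≤ ℓ, ∀ x ∈ L, ∀ y ∈ R, mergeDist X j < dist x y :=
    fun j hj x hx y hy => (hle j hj).trans_lt (hsep x hx y hy)
  have hℓ : clustersAt X (mergeDist X ℓ) = {L, R} :=
    clustersAt_eq_pair hX hL hR (hsepj ℓ le_rfl) (fun x hx y hy => hlink x y (hLl x hx y hy))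
      fun x hx y hy => hlink x y (hRl x hx y hy)
  have hcard : (clustersAt X (mergeDist X ℓ)).ncard = 2 := by
    rw [hℓ, Set.ncard_pair hne]
  refine ⟨⟨ℓ, hℓ.symm, Set.ncard_pair hne⟩, ?_⟩
  have hex : ∃ ℓ : ℕ, (clustersAt X (mergeDist X ℓ)).ncard = 2 := ⟨ℓ, hcard⟩
  rw [SLClusters, dif_pos hex]
  have hj : Nat.find hex ≤ ℓ := Nat.find_min' hex hcard
  have hs := hsepj _ hj
  refine clustersAt_eq_pair hX hL hR hs
    (linked_of_ncard_clustersAt_eq_two hX hdisj hR hs (Nat.find_spec hex))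
    (linked_of_ncard_clustersAt_eq_two (hX.trans (Set.union_comm L R)) hdisj.symm hL
      (fun x hx y hy => dist_comm x y ▸ hs y hy x hx) (Nat.find_spec hex))

theorem pathCost_cons_cons (a b : P) (l : List P) :
    pathCost (a :: b :: l) = max (dist a b) (pathCost (b :: l)) := rfl

theorem pathCost_nonneg (p : List P) : 0 ≤ pathCost p := by
  match p with
  | [] => exact le_rfl
  | [_] => exact le_rfl
  | a :: b :: l => exact dist_nonneg.trans (le_max_left (dist a b) (pathCost (b :: l)))

theorem pathCost_le {D : ℝ} (hD : 0 ≤ D) :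
    ∀ {p : List P}, p.IsChain (fun a b => dist a b ≤ D) → pathCost p ≤ D
  | [], _ => hD
  | [_], _ => hD
  | a :: b :: l, h => by
    rw [List.isChain_cons_cons] at h
    exact max_le h.1 (pathCost_le hD h.2)

/-- A path crossing from `L` to `R` costs at least their separation. -/
theorem le_pathCost_of_separated {L R : Set P} {D : ℝ} (hsep : ∀ x ∈ L, ∀ y ∈ R, D ≤ dist x y) :
    ∀ {p : List P} {x y : P}, (∀ a ∈ p, a ∈ L ∪ R) → p.head? = some x → p.getLast? = some y →
      x ∈ L → y ∉ L → D ≤ pathCost p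
  | [], x, y, _, hh, _, _, _ => by simp at hh
  | [a], x, y, _, hh, hl, hx, hy => by
    simp only [List.head?_cons, Option.some.injEq, List.getLast?_singleton] at hh hl
    subst hh hl
    exact absurd hx hy
  | a :: b :: l, x, y, hp, hh, hl, hx, hy => by
    simp only [List.head?_cons, Option.some.injEq] at hh
    subst hh
    rw [pathCost_cons_cons]
    rcases hp b (by simp) with hb | hb
    · refine le_max_of_le_right (le_pathCost_of_separated hsep
        (fun c hc => hp c (List.mem_cons_of_mem _ hc)) rfl ?_ hb hy)
      rwa [List.getLast?_cons_cons] at hl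
    · exact le_max_of_le_left (hsep a hx b hb)

theorem SLLinked.exists_simple_path {X : Finset P} {D : ℝ} {x y : P} (hx : x ∈ X)
    (hD : 0 ≤ D) (h : SLLinked X D x y) :
    ∃ p : List P, p ≠ [] ∧ p.Nodup ∧ (∀ a ∈ p, a ∈ X) ∧
      p.head? = some x ∧ p.getLast? = some y ∧ pathCost p ≤ D := by
  let G : SimpleGraph P := SimpleGraph.fromRel (SLStep X D)
  have hreach : G.Reachable x y := by
    induction h with
    | refl => exact SimpleGraph.Reachable.refl _
    | @tail b c _ hbc ih =>
      by_cases hne : b = c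
      · exact hne ▸ ih
      · exact ih.trans (SimpleGraph.Adj.reachable
          ((SimpleGraph.fromRel_adj _ _ _).2 ⟨hne, Or.inl hbc⟩))
  have hadj : ∀ a b, G.Adj a b → SLStep X D a b := fun a b hab => by
    rcases ((SimpleGraph.fromRel_adj _ _ _).1 hab).2 with h | h
    · exact h
    · exact ⟨h.2.1, h.1, dist_comm a b ▸ h.2.2⟩
  obtain ⟨p, hp⟩ := hreach.exists_isPath
  refine ⟨p.support, p.support_ne_nil, hp.support_nodup, ?_, ?_, ?_, pathCost_le hD ?_⟩
  · clear hp hreach h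
    induction p with
    | nil => simpa using hx
    | cons hab q ih =>
      intro a ha
      rcases List.mem_cons.1 (by simpa using ha) with rfl | ha
      · exact hx
      · exact ih (hadj _ _ hab).2.1 a ha
  · rw [List.head?_eq_some_head p.support_ne_nil, SimpleGraph.Walk.head_support]
  · rw [List.getLast?_eq_some_getLast p.support_ne_nil, SimpleGraph.Walk.getLast_support]
  · exact p.isChain_adj_support.imp fun a b hab => (hadj a b hab).2.2

theorem minMaxD_le {X : Finset P} {D : ℝ} {x y : P} (hx : x ∈ X) (hD : 0 ≤ D)
    (h : SLLinked X D x y) : minMaxD X x y ≤ D := by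
  obtain ⟨p, h1, h2, h3, h4, h5, h6⟩ := h.exists_simple_path hx hD
  refine le_trans (csInf_le ⟨0, ?_⟩ ?_) h6
  · rintro r ⟨q, -, -, -, -, -, rfl⟩
    exact pathCost_nonneg q
  · exact ⟨p, h1, h2, h3, h4, h5, rfl⟩

theorem le_minMaxD {X : Finset P} {L R : Set P} (hX : (X : Set P) ⊆ L ∪ R) {D : ℝ}
    (hsep : ∀ x ∈ L, ∀ y ∈ R, D ≤ dist x y) {x y : P} (hxX : x ∈ X) (hyX : y ∈ X)
    (hx : x ∈ L) (hy : y ∉ L) : D ≤ minMaxD X x y := by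
  refine le_csInf ?_ ?_
  · obtain ⟨p, h1, h2, h3, h4, h5, -⟩ :=
      (SLLinked.of_dist_le hxX hyX le_rfl).exists_simple_path hxX dist_nonneg
    exact ⟨_, p, h1, h2, h3, h4, h5, rfl⟩
  · rintro r ⟨p, -, -, hp, hh, hl, rfl⟩
    exact le_pathCost_of_separated hsep (fun a ha => hX (hp a ha)) hh hl hx hy

theorem minMaxSet_le {X : Finset P} {S : Set P} {D : ℝ} (hD : 0 ≤ D) (hS : S ⊆ X)
    (h : ∀ x ∈ S, ∀ y ∈ S, SLLinked X D x y) : minMaxSet X S ≤ D := by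
  refine Real.sSup_le ?_ hD
  rintro r ⟨x, hx, y, hy, rfl⟩
  exact minMaxD_le (hS hx) hD (h x hx y hy)

theorem minMaxSet_eq {X : Finset P} {S : Set P} {D : ℝ} (hD : 0 ≤ D) (hS : S ⊆ X)
    (h : ∀ x ∈ S, ∀ y ∈ S, SLLinked X D x y) {x y : P} (hx : x ∈ S) (hy : y ∈ S)
    (hxy : D ≤ minMaxD X x y) : minMaxSet X S = D := by
  refine le_antisymm (minMaxSet_le hD hS h) (hxy.trans (le_csSup ⟨D, ?_⟩ ⟨x, hx, y, hy, rfl⟩))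
  rintro r ⟨u, hu, v, hv, rfl⟩
  exact minMaxD_le (hS hu) hD (h u hu v hv)

theorem le_unifProb_of_avoids {α : Type*} [Fintype α] {m : ℕ} (T₀ T₁ T₂ : Finset α)
    {E : Set (Fin m → α)}
    (hE : ∀ ω : Fin m → α, (∀ i, ω i ∈ T₀) → (∃ i, ω i ∉ T₁) → (∃ i, ω i ∉ T₂) → ω ∈ E) :
    ((T₀.card : ℝ) ^ m - (T₁.card : ℝ) ^ m - (T₂.card : ℝ) ^ m) / (Fintype.card α : ℝ) ^ m ≤
      unifProb E := by
  have hden : (Fintype.card (Fin m → α) : ℝ) = (Fintype.card α : ℝ) ^ m := by simp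
  rw [unifProb, hden]
  gcongr
  have hsub : Fintype.piFinset (fun _ : Fin m => T₀) ⊆
      ((Finset.univ.filter fun a => a ∈ E) ∪ Fintype.piFinset fun _ : Fin m => T₁) ∪
        Fintype.piFinset fun _ : Fin m => T₂ := by
    intro ω hω
    simp only [Finset.mem_union, Finset.mem_filter, Finset.mem_univ, true_and,
      Fintype.mem_piFinset] at hω ⊢
    by_cases h1 : ∀ i, ω i ∈ T₁
    · exact Or.inl (Or.inr h1)
    by_cases h2 : ∀ i, ω i ∈ T₂
    · exact Or.inr h2
    exact Or.inl (Or.inl (hE ω hω (not_forall.1 h1) (not_forall.1 h2)))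
  have hcard := (Finset.card_le_card hsub).trans
    ((Finset.card_union_le _ _).trans (Nat.add_le_add_right (Finset.card_union_le _ _) _))
  simp only [Fintype.card_piFinset_const] at hcard
  have hcast : (T₀.card : ℝ) ^ m ≤ ((Finset.univ.filter fun a => a ∈ E).card : ℝ) +
      (T₁.card : ℝ) ^ m + (T₂.card : ℝ) ^ m := by exact_mod_cast hcard
  linarith

theorem avoidance_bound {t : ℕ} (ht : 3 ≤ t) :
    (0.23 : ℝ) ≤ ((3 * t : ℝ) ^ (3 * t) - (2 * t : ℝ) ^ (3 * t) - (t : ℝ) ^ (3 * t)) /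
      (3 * t + 1 : ℝ) ^ (3 * t) := by
  have htr : (3 : ℝ) ≤ t := by exact_mod_cast ht
  have hpos : (0 : ℝ) < 3 * t := by linarith
  have hmain : (Real.exp 1)⁻¹ ≤ ((3 * t : ℝ) / (3 * t + 1)) ^ (3 * t) := by
    have hle : (1 + 1 / (3 * t : ℝ)) ^ (3 * t) ≤ Real.exp 1 := by
      have h1 : 1 + 1 / (3 * t : ℝ) ≤ Real.exp (1 / (3 * t)) := by
        rw [add_comm]; exact Real.add_one_le_exp _
      calc (1 + 1 / (3 * t : ℝ)) ^ (3 * t) ≤ Real.exp (1 / (3 * t)) ^ (3 * t) := by gcongr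
        _ = Real.exp 1 := by
          rw [← Real.exp_nat_mul]
          congr 1
          push_cast
          field_simp
    have heq : (3 * t : ℝ) / (3 * t + 1) = (1 + 1 / (3 * t : ℝ))⁻¹ := by field_simp
    rw [heq, inv_pow]
    exact inv_anti₀ (by positivity) hle
  have hexp : (0.36 : ℝ) ≤ (Real.exp 1)⁻¹ := by
    rw [le_inv_comm₀ (by norm_num) (Real.exp_pos 1)]
    have := Real.exp_one_lt_d9
    norm_num at this ⊢
    linarith
  have hsmall : ∀ a : ℝ, 0 ≤ a → a ≤ 2 * t → (a / (3 * t + 1)) ^ (3 * t) ≤ 0.03 := by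
    intro a ha0 ha
    have h1 : a / (3 * t + 1) ≤ 2 / 3 := by
      rw [div_le_div_iff₀ (by linarith) (by norm_num)]
      linarith
    calc (a / (3 * t + 1)) ^ (3 * t) ≤ (2 / 3 : ℝ) ^ (3 * t) := by gcongr
      _ ≤ (2 / 3 : ℝ) ^ 9 := pow_le_pow_of_le_one (by norm_num) (by norm_num) (by omega)
      _ ≤ 0.03 := by norm_num
  have h2 := hsmall (2 * t) (by linarith) le_rfl
  have h3 := hsmall t (by linarith) (by linarith)
  rw [sub_div, sub_div, ← div_pow, ← div_pow, ← div_pow]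
  norm_num at hexp h2 h3 ⊢
  linarith

theorem costSet_pair_eq_zero {α : Type*} {S : Finset α} {L R : Set α} (hne : L ≠ R)
    {Gt : Fin 2 → Set α} (hL : L ⊆ Gt 0) (hR : R ⊆ Gt 1) : costSet S {L, R} Gt = 0 := by
  have hmem : (0 : ℝ) ∈ { c : ℝ | ∃ f : Fin 2 → Set α, Function.Injective f ∧
      Set.range f = {L, R} ∧ ∃ σ : Equiv.Perm (Fin 2),
        c = ({ x ∈ (S : Set α) | ∃ j, x ∈ f (σ j) ∧ x ∉ Gt j }.ncard : ℝ) } := by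
    refine ⟨![L, R], ?_, by simp [Set.pair_comm], 1, ?_⟩
    · intro i j
      fin_cases i <;> fin_cases j <;> simp [hne, hne.symm]
    · have : { x ∈ (S : Set α) | ∃ j, x ∈ ![L, R] ((1 : Equiv.Perm (Fin 2)) j) ∧ x ∉ Gt j } =
        ∅ := by
        ext x
        simp only [Set.mem_ofPred_eq, Fin.exists_fin_two, Set.mem_empty_iff_false, iff_false]
        rintro ⟨-, ⟨h, h'⟩ | ⟨h, h'⟩⟩
        · exact h' (hL h)
        · exact h' (hR h)
      rw [this]
      simp
  have h0 : ∀ c ∈ { c : ℝ | ∃ f : Fin 2 → Set α, Function.Injective f ∧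
      Set.range f = {L, R} ∧ ∃ σ : Equiv.Perm (Fin 2),
        c = ({ x ∈ (S : Set α) | ∃ j, x ∈ f (σ j) ∧ x ∉ Gt j }.ncard : ℝ) }, 0 ≤ c := by
    rintro c ⟨f, -, -, σ, rfl⟩
    positivity
  rw [costSet, le_antisymm (csInf_le ⟨0, h0⟩ hmem) (Real.sInf_nonneg h0), mul_zero]

/-- A cluster meeting both ground-truth complements in at least `N` points forces `N` errors. -/
theorem le_costSet {α : Type*} {X : Finset α} {C Gt : Fin 2 → Set α}
    (hC : Function.Injective C) {N : ℕ}
    (i : Fin 2) (h : ∀ j, ∃ T : Finset α, T ⊆ X ∧ N ≤ T.card ∧ ∀ x ∈ T, x ∈ C i ∧ x ∉ Gt j) :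
    (X.card : ℝ)⁻¹ * N ≤ costSet X (Set.range C) Gt := by
  rw [costSet]
  gcongr
  refine le_csInf ⟨_, C, hC, rfl, 1, rfl⟩ ?_
  rintro c ⟨f, -, hf, σ, rfl⟩
  obtain ⟨k, hk⟩ : C i ∈ Set.range f := hf ▸ Set.mem_range_self i
  obtain ⟨T, hTX, hN, hT⟩ := h (σ.symm k)
  rw [← Set.ncard_coe_finset] at hN
  refine Nat.cast_le.2 (hN.trans (Set.ncard_le_ncard ?_ (X.finite_toSet.subset fun x hx => hx.1)))
  intro x hx
  refine ⟨hTX hx, σ.symm k, ?_, (hT x hx).2⟩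
  rw [Equiv.apply_symm_apply, hk]
  exact (hT x hx).1

/-- The `t` points `a, a + 1, …, a + t - 1`. -/
def unitBlock (a : ℝ) (t : ℕ) : Finset ℝ := (Finset.range t).image fun i : ℕ => a + i

theorem card_unitBlock (a : ℝ) (t : ℕ) : (unitBlock a t).card = t := by
  rw [unitBlock, Finset.card_image_of_injective _ fun i j hij => by simpa using hij,
    Finset.card_range]

theorem mem_unitBlock_bounds {a x : ℝ} {t : ℕ} (h : x ∈ unitBlock a t) :
    a ≤ x ∧ x ≤ a + t - 1 := by
  obtain ⟨i, hi, rfl⟩ := Finset.mem_image.1 h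
  have : (i : ℝ) + 1 ≤ t := by exact_mod_cast Finset.mem_range.1 hi
  exact ⟨by have := Nat.cast_nonneg (α := ℝ) i; linarith, by linarith⟩

theorem left_mem_unitBlock {a : ℝ} {t : ℕ} (ht : 0 < t) : a ∈ unitBlock a t :=
  Finset.mem_image.2 ⟨0, Finset.mem_range.2 ht, by simp⟩

theorem right_mem_unitBlock {a : ℝ} {t : ℕ} (ht : 0 < t) : a + t - 1 ∈ unitBlock a t :=
  Finset.mem_image.2 ⟨t - 1, Finset.mem_range.2 (by omega), by
    rw [Nat.cast_sub ht]; push_cast; ring⟩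

/-- The outer block of the bridge instance, forming a single-linkage cluster on its own. -/
def blockA (t : ℕ) : Finset ℝ := unitBlock (-8 * t + 1) t

/-- The middle block of the bridge instance. -/
def blockB (t : ℕ) : Finset ℝ := unitBlock (-4 * t + 1) t

/-- The block of the bridge instance reached from `blockB` only through the bridge point `0`. -/
def blockC (t : ℕ) : Finset ℝ := unitBlock (3 * t) t

/-- Three blocks, the last two joined by the bridge point `0`. -/
def bridgeSet (t : ℕ) : Finset ℝ := blockA t ∪ (blockB t ∪ blockC t ∪ {0})

theorem mem_blockA {t : ℕ} {x : ℝ} (h : x ∈ blockA t) : -8 * (t : ℝ) + 1 ≤ x ∧ x ≤ -7 * t := by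
  have := mem_unitBlock_bounds h
  exact ⟨this.1, by linarith [this.2]⟩

theorem mem_blockB {t : ℕ} {x : ℝ} (h : x ∈ blockB t) : -4 * (t : ℝ) + 1 ≤ x ∧ x ≤ -3 * t := by
  have := mem_unitBlock_bounds h
  exact ⟨this.1, by linarith [this.2]⟩

theorem mem_blockC {t : ℕ} {x : ℝ} (h : x ∈ blockC t) : 3 * (t : ℝ) ≤ x ∧ x ≤ 4 * t - 1 := by
  have := mem_unitBlock_bounds h
  exact ⟨this.1, by linarith [this.2]⟩

theorem mem_bridgeSet {t : ℕ} {x : ℝ} :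
    x ∈ bridgeSet t ↔ x ∈ blockA t ∨ x ∈ blockB t ∨ x ∈ blockC t ∨ x = 0 := by
  simp only [bridgeSet, Finset.mem_union, Finset.mem_singleton, or_assoc]

theorem card_bridgeTail {t : ℕ} (ht : 0 < t) :
    (blockB t ∪ blockC t ∪ {0}).card = 2 * t + 1 := by
  have htr : (0 : ℝ) < t := by exact_mod_cast ht
  rw [Finset.card_union_of_disjoint, Finset.card_union_of_disjoint, Finset.card_singleton,
    blockB, blockC, card_unitBlock, card_unitBlock, two_mul]
  · refine Finset.disjoint_left.2 fun x hx hx' => ?_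
    linarith [mem_blockB hx, mem_blockC hx']
  · refine Finset.disjoint_left.2 fun x hx hx' => ?_
    rw [Finset.mem_singleton] at hx'
    rcases Finset.mem_union.1 hx with hx | hx
    · linarith [mem_blockB hx]
    · linarith [mem_blockC hx]

theorem card_bridgeSet {t : ℕ} (ht : 0 < t) : (bridgeSet t).card = 3 * t + 1 := by
  have htr : (0 : ℝ) < t := by exact_mod_cast ht
  rw [bridgeSet, Finset.card_union_of_disjoint, card_bridgeTail ht, blockA, card_unitBlock]
  · ring
  · refine Finset.disjoint_left.2 fun x hx hx' => ?_
    simp only [Finset.mem_union, Finset.mem_singleton] at hx'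
    rcases hx' with (hx' | hx') | hx'
    · linarith [mem_blockA hx, mem_blockB hx']
    · linarith [mem_blockA hx, mem_blockC hx']
    · linarith [mem_blockA hx]

/-- The single-linkage clusters of the bridge instance. -/
def bridgeClusters (t : ℕ) : Fin 2 → Set ℝ :=
  ![(blockA t : Set ℝ), ((blockB t ∪ blockC t ∪ {0} : Finset ℝ) : Set ℝ)]

/-- The ground truth of the bridge instance. -/
def bridgeTruth (t : ℕ) : Fin 2 → Set ℝ :=
  ![((blockA t ∪ blockB t ∪ {0} : Finset ℝ) : Set ℝ), (blockC t : Set ℝ)]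

theorem isGroundTruth_bridgeTruth {t : ℕ} (ht : 0 < t) :
    IsGroundTruth (bridgeSet t) (bridgeTruth t) := by
  have htr : (0 : ℝ) < t := by exact_mod_cast ht
  have hdisj : Disjoint (bridgeTruth t 0) (bridgeTruth t 1) := by
    refine Set.disjoint_left.2 fun x hx hx' => ?_
    have hx' := mem_blockC (Finset.mem_coe.1 hx')
    have hx : x ∈ blockA t ∪ blockB t ∪ {0} := hx
    simp only [Finset.mem_union, Finset.mem_singleton] at hx
    rcases hx with (hx | hx) | hx
    · linarith [mem_blockA hx]
    · linarith [mem_blockB hx]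
    · linarith
  have hunion : (⋃ i, bridgeTruth t i) = ↑(bridgeSet t) := by
    ext x
    simp only [Set.mem_iUnion, Fin.exists_fin_two, Finset.mem_coe, mem_bridgeSet]
    simp only [bridgeTruth, Matrix.cons_val_zero, Matrix.cons_val_one, Finset.mem_coe,
      Finset.mem_union, Finset.mem_singleton]
    tauto
  refine ⟨fun i => hunion ▸ Set.subset_iUnion _ i, ?_, hunion⟩
  intro i j hij
  fin_cases i <;> fin_cases j
  · exact absurd rfl hij
  · exact hdisj
  · exact hdisj.symm
  · exact absurd rfl hij

theorem linked_blockA {t : ℕ} : ∀ x ∈ bridgeClusters t 0, ∀ y ∈ bridgeClusters t 0,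
    SLLinked (bridgeSet t) (3 * t) x y := by
  intro x hx y hy
  have hx : x ∈ blockA t := hx
  have hy : y ∈ blockA t := hy
  refine SLLinked.of_dist_le (mem_bridgeSet.2 (Or.inl hx)) (mem_bridgeSet.2 (Or.inl hy)) ?_
  have htr : (0 : ℝ) ≤ t := Nat.cast_nonneg t
  have h1 := mem_blockA hx
  have h2 := mem_blockA hy
  rw [Real.dist_eq, abs_le]
  constructor <;> linarith

theorem neg_three_mem_blockB {t : ℕ} (ht : 0 < t) : -3 * (t : ℝ) ∈ blockB t := by
  have := right_mem_unitBlock (a := -4 * (t : ℝ) + 1) ht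
  rwa [show -4 * (t : ℝ) + 1 + t - 1 = -3 * t by ring] at this

theorem linked_bridge {t : ℕ} (ht : 0 < t) : ∀ x ∈ bridgeClusters t 1, ∀ y ∈ bridgeClusters t 1,
    SLLinked (bridgeSet t) (3 * t) x y := by
  have htr : (0 : ℝ) < t := by exact_mod_cast ht
  have hB := neg_three_mem_blockB ht
  have hC : 3 * (t : ℝ) ∈ blockC t := left_mem_unitBlock ht
  have h0 : (0 : ℝ) ∈ bridgeSet t := mem_bridgeSet.2 (by simp)
  have hzero : ∀ x ∈ bridgeClusters t 1, SLLinked (bridgeSet t) (3 * t) x 0 := by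
    intro x hx
    have hx : x ∈ blockB t ∪ blockC t ∪ {0} := hx
    simp only [Finset.mem_union, Finset.mem_singleton] at hx
    rcases hx with (hx | hx) | rfl
    · have hmem : -3 * (t : ℝ) ∈ bridgeSet t := mem_bridgeSet.2 (Or.inr (Or.inl hB))
      refine Relation.ReflTransGen.trans
        (SLLinked.of_dist_le (mem_bridgeSet.2 (Or.inr (Or.inl hx))) hmem ?_)
        (SLLinked.of_dist_le hmem h0 ?_)
      · have := mem_blockB hx
        rw [Real.dist_eq, abs_le]
        constructor <;> linarith
      · rw [Real.dist_eq, abs_le]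
        constructor <;> linarith
    · have hmem : 3 * (t : ℝ) ∈ bridgeSet t := mem_bridgeSet.2 (Or.inr (Or.inr (Or.inl hC)))
      refine Relation.ReflTransGen.trans
        (SLLinked.of_dist_le (mem_bridgeSet.2 (Or.inr (Or.inr (Or.inl hx)))) hmem ?_)
        (SLLinked.of_dist_le hmem h0 ?_)
      · have := mem_blockC hx
        rw [Real.dist_eq, abs_le]
        constructor <;> linarith
      · rw [Real.dist_eq, abs_le]
        constructor <;> linarith
    · exact Relation.ReflTransGen.refl
  exact fun x hx y hy => Relation.ReflTransGen.trans (hzero x hx) (hzero y hy).symm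

theorem bridgeClusters_separated {t : ℕ} : ∀ x ∈ bridgeClusters t 0, ∀ y ∈ bridgeClusters t 1,
    3 * (t : ℝ) + 1 ≤ dist x y := by
  intro x hx y hy
  have htr : (0 : ℝ) ≤ t := Nat.cast_nonneg t
  have hx := mem_blockA (Finset.mem_coe.1 hx)
  have hy : y ∈ blockB t ∪ blockC t ∪ {0} := hy
  have hyl : -4 * (t : ℝ) + 1 ≤ y ∨ t = 0 := by
    simp only [Finset.mem_union, Finset.mem_singleton] at hy
    rcases Nat.eq_zero_or_pos t with h | h
    · exact Or.inr h
    have : (1 : ℝ) ≤ t := by exact_mod_cast h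
    rcases hy with (hy | hy) | rfl
    · exact Or.inl (mem_blockB hy).1
    · exact Or.inl (by linarith [mem_blockC hy])
    · exact Or.inl (by linarith)
  rcases hyl with hyl | rfl
  · rw [dist_comm]
    exact le_trans (by linarith) (le_abs_self (y - x))
  · norm_num at hx
    linarith

theorem bridgeSet_eq_union (t : ℕ) :
    (bridgeSet t : Set ℝ) = bridgeClusters t 0 ∪ bridgeClusters t 1 := by
  simp [bridgeSet, bridgeClusters]

theorem range_bridgeClusters (t : ℕ) :
    Set.range (bridgeClusters t) = {bridgeClusters t 0, bridgeClusters t 1} := by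
  ext S
  simp [Fin.exists_fin_two, eq_comm]

theorem isSLClustering_bridgeClusters {t : ℕ} (ht : 0 < t) :
    IsSLClustering (bridgeSet t) 2 (Set.range (bridgeClusters t)) := by
  rw [range_bridgeClusters]
  exact (SLClusters_two_eq_pair (bridgeSet_eq_union t) ⟨_, left_mem_unitBlock ht⟩
    ⟨(0 : ℝ), by simp [bridgeClusters]⟩ (g := 3 * t) (by positivity)
    (fun x hx y hy => (lt_add_one _).trans_le (bridgeClusters_separated x hx y hy))
    linked_blockA (linked_bridge ht)).1

theorem bridgeClusters_injective {t : ℕ} (ht : 0 < t) :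
    Function.Injective (bridgeClusters t) := by
  have hne : bridgeClusters t 0 ≠ bridgeClusters t 1 := fun h => by
    have h0 : (0 : ℝ) ∈ bridgeClusters t 0 := by
      rw [h]
      simp [bridgeClusters]
    have := mem_blockA (Finset.mem_coe.1 h0)
    have htr : (0 : ℝ) < t := by exact_mod_cast ht
    linarith
  intro i j hij
  fin_cases i <;> fin_cases j
  · rfl
  · exact absurd hij hne
  · exact absurd hij.symm hne
  · rfl

theorem minMaxSet_bridgeClusters_one {t : ℕ} (ht : 0 < t) :
    minMaxSet (bridgeSet t) (bridgeClusters t 1) = 3 * t := by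
  have htr : (0 : ℝ) < t := by exact_mod_cast ht
  have hC : 3 * (t : ℝ) ∈ blockC t := left_mem_unitBlock ht
  have h0 : (0 : ℝ) ∈ bridgeClusters t 1 := by simp [bridgeClusters]
  have h3 : 3 * (t : ℝ) ∈ bridgeClusters t 1 := by simp [bridgeClusters, hC]
  have hsub : bridgeClusters t 1 ⊆ bridgeSet t := bridgeSet_eq_union t ▸ Set.subset_union_right
  refine minMaxSet_eq (by positivity) hsub (linked_bridge ht) h0 h3
    (le_minMaxD (L := Set.Iic 0) (R := Set.Ici (3 * (t : ℝ))) ?_ ?_ (hsub h0) (hsub h3)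
      Set.self_mem_Iic (by simpa using htr))
  · intro x hx
    simp only [Set.mem_union, Set.mem_Iic, Set.mem_Ici]
    rcases mem_bridgeSet.1 (Finset.mem_coe.1 hx) with h | h | h | h
    · exact Or.inl (by linarith [mem_blockA h])
    · exact Or.inl (by linarith [mem_blockB h])
    · exact Or.inr (mem_blockC h).1
    · exact Or.inl h.le
  · intro x hx y hy
    rw [Set.mem_Iic] at hx
    rw [Set.mem_Ici] at hy
    rw [dist_comm]
    exact le_trans (by linarith) (le_abs_self (y - x))

theorem minMaxSet_bridgeSet {t : ℕ} (ht : 0 < t) :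
    minMaxSet (bridgeSet t) (bridgeSet t) = 3 * t + 1 := by
  have htr : (0 : ℝ) < t := by exact_mod_cast ht
  have hA : -7 * (t : ℝ) ∈ bridgeClusters t 0 := by
    have := right_mem_unitBlock (a := -8 * (t : ℝ) + 1) ht
    rwa [show -8 * (t : ℝ) + 1 + t - 1 = -7 * t by ring] at this
  have hB : -4 * (t : ℝ) + 1 ∈ bridgeClusters t 1 := by
    have : -4 * (t : ℝ) + 1 ∈ blockB t := left_mem_unitBlock ht
    exact Finset.mem_coe.2 (Finset.mem_union_left _ (Finset.mem_union_left _ this))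
  have hmem : ∀ x, x ∈ bridgeSet t ↔ x ∈ bridgeClusters t 0 ∨ x ∈ bridgeClusters t 1 := fun x => by
    rw [← Finset.mem_coe, bridgeSet_eq_union, Set.mem_union]
  have hAm := (hmem _).2 (Or.inl hA)
  have hBm := (hmem _).2 (Or.inr hB)
  have h01 : ∀ x ∈ bridgeClusters t 0, ∀ y ∈ bridgeClusters t 1,
      SLLinked (bridgeSet t) (3 * t + 1) x y := fun x hx y hy => by
    refine Relation.ReflTransGen.trans ((linked_blockA x hx _ hA).mono (by linarith))
      (Relation.ReflTransGen.trans (SLLinked.of_dist_le hAm hBm ?_)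
        ((linked_bridge ht _ hB y hy).mono (by linarith)))
    rw [Real.dist_eq, abs_le]
    constructor <;> linarith
  refine minMaxSet_eq (by positivity) subset_rfl ?_ hAm hBm
    (le_minMaxD (bridgeSet_eq_union t).subset bridgeClusters_separated hAm hBm hA ?_)
  · intro x hx y hy
    rcases (hmem x).1 hx with hx | hx <;> rcases (hmem y).1 hy with hy | hy
    · exact (linked_blockA x hx y hy).mono (by linarith)
    · exact h01 x hx y hy
    · exact (h01 y hy x hx).symm
    · exact (linked_bridge ht x hx y hy).mono (by linarith)
  · intro h
    linarith [mem_blockA (Finset.mem_coe.1 h)]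

theorem zetaSL_bridge {t : ℕ} (ht : 0 < t) :
    zetaSL (bridgeSet t) (bridgeClusters t) = ((3 * t + 1 : ℕ) : ℝ) := by
  have htr : (1 : ℝ) ≤ t := by exact_mod_cast ht
  have hinf : sInf { r | ∃ i j : Fin 2, i ≠ j ∧
      r = minMaxSet (bridgeSet t) (bridgeClusters t i ∪ bridgeClusters t j) } = 3 * t + 1 := by
    have hset : { r | ∃ i j : Fin 2, i ≠ j ∧
        r = minMaxSet (bridgeSet t) (bridgeClusters t i ∪ bridgeClusters t j) } =
        {3 * (t : ℝ) + 1} := by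
      ext r
      simp only [Fin.exists_fin_two, Set.mem_ofPred_eq, Set.mem_singleton_iff,
        Set.union_comm (bridgeClusters t 1) (bridgeClusters t 0), ← bridgeSet_eq_union,
        minMaxSet_bridgeSet ht]
      simp
    rw [hset, csInf_singleton]
  have hsup : sSup { r | ∃ i : Fin 2, r = minMaxSet (bridgeSet t) (bridgeClusters t i) } =
      3 * t := by
    refine IsGreatest.csSup_eq ⟨⟨1, (minMaxSet_bridgeClusters_one ht).symm⟩, ?_⟩
    rintro r ⟨i, rfl⟩
    fin_cases i
    · exact minMaxSet_le (by positivity) (bridgeSet_eq_union t ▸ Set.subset_union_left)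
        linked_blockA
    · exact (minMaxSet_bridgeClusters_one ht).le
  have hceil : ⌈(3 * (t : ℝ) + 1 - 3 * t) / (3 * t)⌉ = 1 := by
    rw [Int.ceil_eq_iff]
    constructor
    · norm_num
      exact ht
    · rw [div_le_iff₀ (by positivity)]
      push_cast
      linarith
  rw [zetaSL, hinf, hsup, hceil, card_bridgeSet ht]
  simp

theorem costSet_bridgeSet {t : ℕ} (ht : 0 < t) :
    (1 / 12 : ℝ) ≤
      costSet (bridgeSet t) (Set.range (bridgeClusters t)) (bridgeTruth t) := by
  have htr : (1 : ℝ) ≤ t := by exact_mod_cast ht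
  refine le_trans ?_ (le_costSet (bridgeClusters_injective ht) (N := t) 1 ?_)
  · rw [card_bridgeSet ht, inv_mul_eq_div, div_le_div_iff₀ (by norm_num) (by positivity)]
    push_cast
    linarith
  · have hgt := (isGroundTruth_bridgeTruth ht).2.1
    intro j
    fin_cases j
    · refine ⟨blockC t, fun x hx => mem_bridgeSet.2 (Or.inr (Or.inr (Or.inl hx))),
        (card_unitBlock _ _).ge, fun x hx => ⟨by simp [bridgeClusters, hx], ?_⟩⟩
      exact Set.disjoint_right.1 (hgt (show (0 : Fin 2) ≠ 1 by decide)) (Finset.mem_coe.2 hx)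
    · refine ⟨blockB t, fun x hx => mem_bridgeSet.2 (Or.inr (Or.inl hx)),
        (card_unitBlock _ _).ge, fun x hx => ⟨by simp [bridgeClusters, hx], ?_⟩⟩
      exact Set.disjoint_left.1 (hgt (show (0 : Fin 2) ≠ 1 by decide))
        (by simp [bridgeTruth, hx])

/-- Without the bridge point, single linkage on a sample recovers the ground truth. -/
theorem costSet_of_bridge_missing {t : ℕ} {S : Finset ℝ} (hS : S ⊆ bridgeSet t)
    (h0 : (0 : ℝ) ∉ S) (hC : ∃ x ∈ S, x ∉ blockA t ∪ blockB t) (hAB : ∃ x ∈ S, x ∉ blockC t) :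
    costSet S (SLClusters S 2) (bridgeTruth t) = 0 := by
  set L : Set ℝ := ↑S ∩ ↑(blockA t ∪ blockB t) with hL
  set R : Set ℝ := ↑S ∩ ↑(blockC t) with hR
  have hmem : ∀ x ∈ S, x ∈ blockA t ∪ blockB t ∨ x ∈ blockC t := fun x hx => by
    rcases mem_bridgeSet.1 (hS hx) with h | h | h | h
    · exact Or.inl (Finset.mem_union_left _ h)
    · exact Or.inl (Finset.mem_union_right _ h)
    · exact Or.inr h
    · exact absurd (h ▸ hx) h0
  have hLne : L.Nonempty := by
    obtain ⟨x, hx, hx'⟩ := hAB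
    exact ⟨x, hx, (hmem x hx).resolve_right hx'⟩
  have hRne : R.Nonempty := by
    obtain ⟨x, hx, hx'⟩ := hC
    exact ⟨x, hx, (hmem x hx).resolve_left hx'⟩
  have ht : 0 < t := by
    rcases Nat.eq_zero_or_pos t with rfl | h
    · obtain ⟨x, -, hx⟩ := hRne
      simp [blockC, unitBlock] at hx
    · exact h
  have htr : (1 : ℝ) ≤ t := by exact_mod_cast ht
  have hLb : ∀ x ∈ L, -8 * (t : ℝ) + 1 ≤ x ∧ x ≤ -3 * t := by
    rintro x ⟨-, hx⟩
    rcases Finset.mem_union.1 (Finset.mem_coe.1 hx) with h | h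
    · have := mem_blockA h
      constructor <;> linarith
    · have := mem_blockB h
      constructor <;> linarith
  have hsep : ∀ x ∈ L, ∀ y ∈ R, 5 * (t : ℝ) < dist x y := by
    intro x hx y hy
    have h1 := hLb x hx
    have h2 := mem_blockC (Finset.mem_coe.1 hy.2)
    rw [dist_comm]
    exact lt_of_lt_of_le (by linarith) (le_abs_self (y - x))
  have hX : (S : Set ℝ) = L ∪ R := by
    rw [hL, hR, ← Set.inter_union_distrib_left]
    exact (Set.inter_eq_left.2 hmem).symm
  have hcl : SLClusters S 2 = {L, R} := by
    refine (SLClusters_two_eq_pair hX hLne hRne (g := 5 * t) (by positivity) hsep ?_ ?_).2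
    · intro x hx y hy
      refine SLLinked.of_dist_le hx.1 hy.1 ?_
      have h1 := hLb x hx
      have h2 := hLb y hy
      rw [Real.dist_eq, abs_le]
      constructor <;> linarith
    · intro x hx y hy
      refine SLLinked.of_dist_le hx.1 hy.1 ?_
      have h1 := mem_blockC (Finset.mem_coe.1 hx.2)
      have h2 := mem_blockC (Finset.mem_coe.1 hy.2)
      rw [Real.dist_eq, abs_le]
      constructor <;> linarith
  rw [hcl]
  refine costSet_pair_eq_zero ?_ ?_ Set.inter_subset_right
  · intro h
    obtain ⟨x, hx⟩ := hLne
    have := hsep x hx x (h ▸ hx)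
    rw [dist_self] at this
    linarith
  · rintro x ⟨-, hx⟩
    exact Finset.mem_coe.2 (Finset.mem_union_left _ (Finset.mem_coe.1 hx))

theorem card_subtype_filter_le {α : Type*} (X T : Finset α) :
    (Finset.univ.filter fun x : {x // x ∈ X} => (x : α) ∈ T).card ≤ T.card :=
  Finset.card_le_card_of_injOn Subtype.val (fun x hx => by simpa using hx)
    Subtype.val_injective.injOn

theorem unifProb_bridge {t m : ℕ} (ht : 3 ≤ t) (hm : m = 3 * t) :
    (0.23 : ℝ) ≤ unifProb { ω : Fin m → {x // x ∈ bridgeSet t} |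
      1 / 12 ≤ |costSet (sampleFinset (bridgeSet t) ω)
          (SLClusters (sampleFinset (bridgeSet t) ω) 2) (bridgeTruth t) -
        costSet (bridgeSet t) (Set.range (bridgeClusters t)) (bridgeTruth t)| } := by
  have ht0 : 0 < t := by omega
  have h0 : (0 : ℝ) ∈ bridgeSet t := mem_bridgeSet.2 (by simp)
  refine le_trans ?_ (le_unifProb_of_avoids (Finset.univ.erase ⟨0, h0⟩)
    (Finset.univ.filter fun x : {x // x ∈ bridgeSet t} => (x : ℝ) ∈ blockA t ∪ blockB t)
    (Finset.univ.filter fun x : {x // x ∈ bridgeSet t} => (x : ℝ) ∈ blockC t) ?_)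
  · refine (avoidance_bound ht).trans ?_
    have hcard : Fintype.card {x // x ∈ bridgeSet t} = 3 * t + 1 := by
      rw [Fintype.card_coe, card_bridgeSet ht0]
    have hAB : (blockA t ∪ blockB t).card ≤ 2 * t := (Finset.card_union_le _ _).trans
      (by rw [blockA, blockB, card_unitBlock, card_unitBlock, two_mul])
    have h1 := (card_subtype_filter_le (bridgeSet t) (blockA t ∪ blockB t)).trans hAB
    have h2 := (card_subtype_filter_le (bridgeSet t) (blockC t)).trans (card_unitBlock _ _).le
    rw [Finset.card_erase_of_mem (Finset.mem_univ _), Finset.card_univ, hcard, hm,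
      Nat.add_sub_cancel]
    have h1' := Nat.cast_le (α := ℝ).2 h1
    push_cast at h1' ⊢
    gcongr
  · intro ω hω h1 h2
    have hmem : ∀ i, (ω i : ℝ) ∈ sampleFinset (bridgeSet t) ω := fun i =>
      Finset.mem_image_of_mem _ (Finset.mem_univ i)
    obtain ⟨i, hi⟩ := h1
    obtain ⟨j, hj⟩ := h2
    have hcost : costSet (sampleFinset (bridgeSet t) ω)
        (SLClusters (sampleFinset (bridgeSet t) ω) 2) (bridgeTruth t) = 0 := by
      refine costSet_of_bridge_missing ?_ ?_ ⟨_, hmem i, by simpa using hi⟩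
        ⟨_, hmem j, by simpa using hj⟩
      · intro x hx
        obtain ⟨k, -, rfl⟩ := Finset.mem_image.1 hx
        exact (ω k).2
      · intro hx
        obtain ⟨k, -, hk⟩ := Finset.mem_image.1 hx
        exact Finset.ne_of_mem_erase (hω k) (Subtype.ext hk)
    rw [Set.mem_ofPred_eq, hcost, zero_sub, abs_neg]
    exact (costSet_bridgeSet ht0).trans (le_abs_self _)

/-- For any `n ≥ 51` with `n ≡ 1 (mod 3)`, there is a clustering instance
`X ⊂ ℝ` on `n` points and a ground-truth 2-clustering `G` of `X` such that `ζ_{2,SL}(X) = n`,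
the clusters `C = SingleLinkage(X,2)` satisfy `min_i |C_i| ≥ n/6`, and for a random subsample
`X_m` of `m = n−1` points drawn uniformly with replacement from `X`, with probability at least
`0.23`, `|cost(SingleLinkage(X_m,2);G) − cost(SingleLinkage(X,2);G)| ≥ 1/12`. -/
theorem stmt10 (n : ℕ) (hn : 51 ≤ n) (hmod : n % 3 = 1) :
    ∃ X : Finset ℝ, X.card = n ∧
      ∃ Gt : Fin 2 → Set ℝ, IsGroundTruth X Gt ∧
        ∃ C : Fin 2 → Set ℝ, Function.Injective C ∧ IsSLClustering X 2 (Set.range C) ∧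
          zetaSL X C = (n : ℝ) ∧ (∀ i, (n : ℝ) / 6 ≤ ((C i).ncard : ℝ)) ∧
          (0.23 : ℝ) ≤ unifProb { ω : Fin (n - 1) → {x // x ∈ X} |
              1 / 12 ≤ |costSet (sampleFinset X ω) (SLClusters (sampleFinset X ω) 2) Gt -
                costSet X (Set.range C) Gt| } := by
  obtain ⟨t, rfl⟩ : ∃ t, n = 3 * t + 1 := ⟨n / 3, by omega⟩
  have ht : 0 < t := by omega
  have htr : (1 : ℝ) ≤ t := by exact_mod_cast ht
  refine ⟨bridgeSet t, card_bridgeSet ht, bridgeTruth t, isGroundTruth_bridgeTruth ht,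
    bridgeClusters t, bridgeClusters_injective ht, isSLClustering_bridgeClusters ht,
    zetaSL_bridge ht, ?_, unifProb_bridge (by omega) (by omega)⟩
  intro i
  fin_cases i
  · change _ ≤ (((blockA t : Set ℝ).ncard : ℕ) : ℝ)
    rw [Set.ncard_coe_finset, blockA, card_unitBlock]
    push_cast
    linarith
  · change _ ≤ ((((blockB t ∪ blockC t ∪ {0} : Finset ℝ) : Set ℝ).ncard : ℕ) : ℝ)
    rw [Set.ncard_coe_finset, card_bridgeTail ht]
    push_cast
    linarith
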